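/- arXiv:1511.03907 — 2 statements merged into one kernel-verified Lean document; each statement's English description precedes it below -/
import Mathlib

section
/- Let β̄₀, β̄₁, …, β̄_g be positive integers; set e_i = gcd(β̄₀, …, β̄_i) for 0 ≤ i ≤ g and n_i = e_{i−1}/e_i for 1 ≤ i ≤ g. Suppose b₀, …, b_g and b′₀, …, b′_g are natural numbers with b_j < n_j and b′_j < n_j for all 1 ≤ j ≤ g, and Σ_{j=0}^{g} b_j·β̄_j = Σ_{j=0}^{g} b′_j·β̄_j. Then b_j = b′_j for all 0 ≤ j ≤ g. -/
/-- With `e i = gcd(β̄₀, …, β̄ᵢ)` and `nᵢ = e_{i−1}/eᵢ`, two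
representations `Σ bⱼ·β̄ⱼ = Σ b'ⱼ·β̄ⱼ` with digits `bⱼ, b'ⱼ < nⱼ` for
`1 ≤ j ≤ g` coincide. -/
theorem digits_unique
    (g : ℕ) (β e n : ℕ → ℕ)
    (hβ : ∀ i ≤ g, 0 < β i)
    (he : ∀ i ≤ g, e i = (Finset.range (i + 1)).gcd β)
    (hn : ∀ i, 1 ≤ i → i ≤ g → n i = e (i - 1) / e i)
    (b b' : ℕ → ℕ)
    (hb : ∀ j, 1 ≤ j → j ≤ g → b j < n j)
    (hb' : ∀ j, 1 ≤ j → j ≤ g → b' j < n j)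
    (hsum : ∑ j ∈ Finset.range (g + 1), b j * β j =
      ∑ j ∈ Finset.range (g + 1), b' j * β j) :
    ∀ j ≤ g, b j = b' j := by
  induction g with
  | zero =>
    intro j hj
    obtain rfl : j = 0 := by omega
    simp only [zero_add, Finset.sum_range_one] at hsum
    exact Nat.eq_of_mul_eq_mul_right (hβ 0 le_rfl) hsum
  | succ g ih =>
    rw [Finset.sum_range_succ _ (g + 1), Finset.sum_range_succ _ (g + 1)] at hsum
    have e_dvd_sum (c : ℕ → ℕ) : e g ∣ ∑ j ∈ Finset.range (g + 1), c j * β j := by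
      rw [he g (by omega)]
      exact Finset.dvd_sum fun j hj => (Finset.gcd_dvd hj).mul_left _
    have e_pos : 0 < e g := by
      rw [he g (by omega)]
      exact Nat.pos_of_dvd_of_pos (Finset.gcd_dvd (Finset.self_mem_range_succ g))
        (hβ g (by omega))
    have n_eq : n (g + 1) = e g / Nat.gcd (e g) (β (g + 1)) := by
      rw [hn (g + 1) (by omega) le_rfl, he (g + 1) le_rfl, Finset.range_add_one,
        Finset.gcd_insert, ← he g (by omega), Nat.add_sub_cancel, Nat.gcd_comm]
      rfl
    have mul_modEq : b (g + 1) * β (g + 1) ≡ b' (g + 1) * β (g + 1) [MOD e g] :=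
      Nat.ModEq.add_left_cancel
        ((Nat.modEq_zero_iff_dvd.2 (e_dvd_sum b)).trans
          (Nat.modEq_zero_iff_dvd.2 (e_dvd_sum b')).symm)
        (congrArg (· % e g) hsum)
    have last_eq : b (g + 1) = b' (g + 1) := by
      have h := Nat.ModEq.cancel_right_div_gcd e_pos mul_modEq
      rw [← n_eq] at h
      exact h.eq_of_lt_of_lt (hb _ (by omega) le_rfl) (hb' _ (by omega) le_rfl)
    rw [last_eq] at hsum
    intro j hj
    obtain hlt | rfl := Nat.lt_or_eq_of_le hj
    · exact ih (fun i hi => hβ i (by omega)) (fun i hi => he i (by omega))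
        (fun i h1 hi => hn i h1 (by omega)) (fun i h1 hi => hb i h1 (by omega))
        (fun i h1 hi => hb' i h1 (by omega)) (Nat.add_right_cancel hsum) j (by omega)
    · exact last_eq
end

section
/- Let β̄₀, β̄₁, …, β̄_g be positive integers; set e_i = gcd(β̄₀, …, β̄_i) for 0 ≤ i ≤ g and n_i = e_{i−1}/e_i for 1 ≤ i ≤ g. Assume that for every 1 ≤ j ≤ g, the number n_j·β̄_j lies in the additive submonoid of ℕ generated by β̄₀, …, β̄_{j−1}. Then for every 1 ≤ i ≤ g there exists a unique system of natural numbers b_{i0}, b_{i1}, …, b_{i,i−1} such that b_{ij} < n_j for all 1 ≤ j < i and n_i·β̄_i = Σ_{0 ≤ j < i} b_{ij}·β̄_j. -/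
/-- Division with remainder by successive generators: elements of the submonoid generated by
`β 0, …, β k` have an expansion with bounded digits. -/
theorem exists_digits_of_mem_closure (β n : ℕ → ℕ) (k : ℕ)
    (hn : ∀ j, 1 ≤ j → j ≤ k → 0 < n j)
    (hmem : ∀ j, 1 ≤ j → j ≤ k → n j * β j ∈ AddSubmonoid.closure (β '' Set.Iio j))
    {x : ℕ} (hx : x ∈ AddSubmonoid.closure (β '' Set.Iio (k + 1))) :
    ∃ b : ℕ → ℕ, (∀ j, k + 1 ≤ j → b j = 0) ∧ (∀ j, 1 ≤ j → j < k + 1 → b j < n j) ∧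
      x = ∑ j ∈ Finset.range (k + 1), b j * β j := by
  induction k generalizing x with
  | zero =>
    have h : β '' Set.Iio (0 + 1) = {β 0} := by
      ext y
      simp
    rw [h, AddSubmonoid.mem_closure_singleton] at hx
    obtain ⟨c, rfl⟩ := hx
    refine ⟨fun j => if j = 0 then c else 0, fun j hj => if_neg (by omega),
      fun j _ _ => by omega, ?_⟩
    simp
  | succ k ih =>
    have h : β '' Set.Iio (k + 1 + 1) = β '' Set.Iio (k + 1) ∪ {β (k + 1)} := by
      rw [← Set.image_singleton, ← Set.image_union]
      congr 1
      ext y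
      simp only [Set.mem_Iio, Set.mem_union, Set.mem_singleton_iff]
      omega
    rw [h, AddSubmonoid.closure_union, AddSubmonoid.mem_sup] at hx
    obtain ⟨y, hy, z, hz, rfl⟩ := hx
    obtain ⟨c, rfl⟩ := AddSubmonoid.mem_closure_singleton.mp hz
    obtain ⟨b, hb0, hb, hsum⟩ := ih (fun j h1 h2 => hn j h1 (by omega))
      (fun j h1 h2 => hmem j h1 (by omega))
      (add_mem hy (nsmul_mem (hmem (k + 1) (by omega) le_rfl) (c / n (k + 1))))
    refine ⟨Function.update b (k + 1) (c % n (k + 1)), fun j hj => ?_, fun j h1 h2 => ?_, ?_⟩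
    · rw [Function.update_of_ne (by omega)]
      exact hb0 j (by omega)
    · rcases eq_or_ne j (k + 1) with rfl | hne
      · rw [Function.update_self]
        exact Nat.mod_lt _ (hn _ h1 le_rfl)
      · rw [Function.update_of_ne hne]
        exact hb j h1 (by omega)
    · have hcongr : ∑ j ∈ Finset.range (k + 1),
          Function.update b (k + 1) (c % n (k + 1)) j * β j =
          ∑ j ∈ Finset.range (k + 1), b j * β j :=
        Finset.sum_congr rfl fun j hj => by
          rw [Function.update_of_ne (Finset.mem_range.mp hj).ne]
      rw [Finset.sum_range_succ, hcongr, ← hsum, Function.update_self]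
      simp only [smul_eq_mul]
      conv_lhs => rw [← Nat.div_add_mod c (n (k + 1))]
      ring

/-- Expansions with digits bounded by the successive quotients of the gcds are unique. -/
theorem digits_eq_of_sum_eq (β e n : ℕ → ℕ) (k : ℕ) (hβ : 0 < β 0)
    (he : ∀ i ≤ k, e i = (Finset.range (i + 1)).gcd β)
    (hn : ∀ i, 1 ≤ i → i ≤ k → n i = e (i - 1) / e i)
    {b c : ℕ → ℕ} (hb : ∀ j, 1 ≤ j → j < k + 1 → b j < n j)
    (hc : ∀ j, 1 ≤ j → j < k + 1 → c j < n j)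
    (hsum : ∑ j ∈ Finset.range (k + 1), b j * β j = ∑ j ∈ Finset.range (k + 1), c j * β j) :
    ∀ j < k + 1, b j = c j := by
  induction k with
  | zero =>
    intro j hj
    obtain rfl : j = 0 := by omega
    simpa [hβ.ne'] using hsum
  | succ k ih =>
    have hdvd (a : ℕ → ℕ) : e k ∣ ∑ j ∈ Finset.range (k + 1), a j * β j := by
      rw [he k (by omega)]
      exact Finset.dvd_sum fun j hj => (Finset.gcd_dvd hj).mul_left _
    have hgcd : e (k + 1) = Nat.gcd (e k) (β (k + 1)) := by
      rw [he _ le_rfl, he k (by omega), Finset.range_add_one (n := k + 1), Finset.gcd_insert,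
        Nat.gcd_comm]
      rfl
    have hpos : 0 < e k := by
      refine Nat.pos_of_ne_zero fun h0 => hβ.ne' ?_
      rw [he k (by omega), Finset.gcd_eq_zero_iff] at h0
      exact h0 0 (by simp)
    have htop : b (k + 1) = c (k + 1) := by
      have hmod : b (k + 1) * β (k + 1) ≡ c (k + 1) * β (k + 1) [MOD e k] := by
        rw [Finset.sum_range_succ, Finset.sum_range_succ _ (k + 1)] at hsum
        refine Nat.ModEq.add_left_cancel
          ((Nat.modEq_zero_iff_dvd.mpr (hdvd b)).trans
            (Nat.modEq_zero_iff_dvd.mpr (hdvd c)).symm) ?_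
        rw [hsum]
      have hmod' := Nat.ModEq.cancel_right_div_gcd hpos hmod
      rw [← hgcd] at hmod'
      have hnk := hn (k + 1) (by omega) le_rfl
      rw [Nat.add_sub_cancel] at hnk
      rw [← hnk] at hmod'
      exact hmod'.eq_of_lt_of_lt (hb _ (by omega) (by omega)) (hc _ (by omega) (by omega))
    rw [Finset.sum_range_succ, Finset.sum_range_succ _ (k + 1), htop] at hsum
    have hlow := ih (fun i hi => he i (by omega)) (fun i h1 h2 => hn i h1 (by omega))
      (fun j h1 h2 => hb j h1 (by omega)) (fun j h1 h2 => hc j h1 (by omega))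
      (Nat.add_right_cancel hsum)
    intro j hj
    rcases eq_or_ne j (k + 1) with rfl | hne
    · exact htop
    · exact hlow j (by omega)


/-- With `e i = gcd(β̄₀, …, β̄ᵢ)` and `nᵢ = e_{i−1}/eᵢ`, if for
each `1 ≤ j ≤ g` the number `nⱼ·β̄ⱼ` lies in the submonoid of `ℕ` generated by
`β̄₀, …, β̄_{j−1}`, then for each `1 ≤ i ≤ g` there is a unique system of
natural numbers `b_{i0}, …, b_{i,i−1}` with `b_{ij} < nⱼ` for `1 ≤ j < i` and
`nᵢ·β̄ᵢ = Σ_{0 ≤ j < i} b_{ij}·β̄ⱼ`. -/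
theorem exists_unique_digits
    (g : ℕ) (β e n : ℕ → ℕ)
    (hβ : ∀ i ≤ g, 0 < β i)
    (he : ∀ i ≤ g, e i = (Finset.range (i + 1)).gcd β)
    (hn : ∀ i, 1 ≤ i → i ≤ g → n i = e (i - 1) / e i)
    (hmem : ∀ j, 1 ≤ j → j ≤ g →
      n j * β j ∈ AddSubmonoid.closure (β '' Set.Iio j)) :
    ∀ i, 1 ≤ i → i ≤ g →
      ∃! b : ℕ → ℕ,
        (∀ j, i ≤ j → b j = 0) ∧
        (∀ j, 1 ≤ j → j < i → b j < n j) ∧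
        n i * β i = ∑ j ∈ Finset.range i, b j * β j := by
  have hpos (j : ℕ) (h1 : 1 ≤ j) (h2 : j ≤ g) : 0 < n j := by
    have hne (i : ℕ) (hi : i ≤ g) : 0 < e i := by
      refine Nat.pos_of_ne_zero fun h0 => (hβ 0 (by omega)).ne' ?_
      rw [he i hi, Finset.gcd_eq_zero_iff] at h0
      exact h0 0 (by simp)
    have hdvd : e j ∣ e (j - 1) := by
      rw [he j h2, he (j - 1) (by omega)]
      exact Finset.gcd_mono (Finset.range_mono (by omega))
    rw [hn j h1 h2]
    exact Nat.div_pos (Nat.le_of_dvd (hne _ (by omega)) hdvd) (hne _ h2)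
  intro i h1 h2
  obtain ⟨k, rfl⟩ := Nat.exists_eq_add_of_le' h1
  obtain ⟨b, hb0, hb, hsum⟩ := exists_digits_of_mem_closure β n k
    (fun j h1 _ => hpos j h1 (by omega)) (fun j h1 _ => hmem j h1 (by omega))
    (hmem (k + 1) h1 h2)
  refine ⟨b, ⟨hb0, hb, hsum⟩, ?_⟩
  rintro c ⟨hc0, hc, hcsum⟩
  funext j
  rcases lt_or_ge j (k + 1) with hj | hj
  · exact digits_eq_of_sum_eq β e n k (hβ 0 (by omega)) (fun i _ => he i (by omega))
      (fun i h1 _ => hn i h1 (by omega)) hc hb (hcsum.symm.trans hsum) j hj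
  · rw [hc0 j hj, hb0 j hj]
end
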